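/- arXiv:1404.5948 — 2 statements merged into one kernel-verified Lean document; each statement's English description precedes it below -/
import Mathlib

section
/- Every complete orthomodular lattice L is Boolean saturated: for each p ∈ L, the set {z ∈ Z(L) : p ≤ z} of central upper bounds of p has a minimum element, namely ◇p = inf{z ∈ Z(L) : p ≤ z}, which is itself central and satisfies p ≤ ◇p. -/
universe u

/-- An orthomodular structure on a bounded lattice: an involutive De Morgan
orthocomplement satisfying the orthomodular law. -/
class OrthoStructure (α : Type u) [Lattice α] [BoundedOrder α] where
  ocompl : α → α
  ocompl_ocompl : ∀ x : α, ocompl (ocompl x) = x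
  ocompl_sup : ∀ x y : α, ocompl (x ⊔ y) = ocompl x ⊓ ocompl y
  inf_ocompl : ∀ x : α, x ⊓ ocompl x = ⊥
  orthomodular : ∀ x y : α, x ⊔ (ocompl x ⊓ (x ⊔ y)) = x ⊔ y

open OrthoStructure

variable {α : Type u} [Lattice α] [BoundedOrder α] [OrthoStructure α]

/-- Both distributive identities for the ordered triple `(x, y, w)`. -/
def DistribTriple (x y w : α) : Prop :=
  (x ⊔ y) ⊓ w = (x ⊓ w) ⊔ (y ⊓ w) ∧ (x ⊓ y) ⊔ w = (x ⊔ w) ⊓ (y ⊔ w)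

/-- `z` is central: both distributive identities hold for every permutation of `(a, b, z)`. -/
def IsCentral (z : α) : Prop :=
  ∀ a b : α, DistribTriple a b z ∧ DistribTriple a z b ∧ DistribTriple b a z ∧
    DistribTriple b z a ∧ DistribTriple z a b ∧ DistribTriple z b a

/-- The center `Z(α)` of an orthomodular lattice. -/
def center (α : Type u) [Lattice α] [BoundedOrder α] [OrthoStructure α] : Set α :=
  {z | IsCentral z}

lemma ocompl_inf (x y : α) : ocompl (x ⊓ y) = ocompl x ⊔ ocompl y := by
  rw [← ocompl_ocompl (ocompl x ⊔ ocompl y), ocompl_sup, ocompl_ocompl, ocompl_ocompl]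

lemma ocompl_le_ocompl {x y : α} (h : x ≤ y) : ocompl y ≤ ocompl x := by
  have := ocompl_sup x y
  rw [sup_eq_right.2 h] at this
  exact this ▸ inf_le_left

lemma sup_ocompl_inf_of_le {x y : α} (h : x ≤ y) : x ⊔ (ocompl x ⊓ y) = y := by
  have := orthomodular x y
  rwa [sup_eq_right.2 h] at this

lemma inf_sup_ocompl_of_le {x y : α} (h : x ≤ y) : y ⊓ (x ⊔ ocompl y) = x := by
  have := congrArg ocompl (sup_ocompl_inf_of_le (ocompl_le_ocompl h))
  rwa [ocompl_sup, ocompl_ocompl, ocompl_inf, ocompl_ocompl, sup_comm] at this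

/-- `z` commutes with every element, in the sense of orthomodular lattices. -/
def CommutesWithAll (z : α) : Prop :=
  ∀ a : α, a ≤ (a ⊓ z) ⊔ (a ⊓ ocompl z)

namespace CommutesWithAll

lemma compl {z : α} (hz : CommutesWithAll z) : CommutesWithAll (ocompl z) := fun a => by
  rw [ocompl_ocompl, sup_comm]
  exact hz a

lemma sup_inf_right {z : α} (hz : CommutesWithAll z) (a b : α) :
    (a ⊔ b) ⊓ z = (a ⊓ z) ⊔ (b ⊓ z) := by
  refine le_antisymm ?_ (sup_le (inf_le_inf_right z le_sup_left) (inf_le_inf_right z le_sup_right))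
  have hm : (a ⊓ z) ⊔ (b ⊓ z) ≤ z := sup_le inf_le_right inf_le_right
  have ha : a ≤ ((a ⊓ z) ⊔ (b ⊓ z)) ⊔ ocompl z :=
    (hz a).trans (sup_le_sup le_sup_left inf_le_right)
  have hb : b ≤ ((a ⊓ z) ⊔ (b ⊓ z)) ⊔ ocompl z :=
    (hz b).trans (sup_le_sup le_sup_right inf_le_right)
  calc (a ⊔ b) ⊓ z ≤ z ⊓ (((a ⊓ z) ⊔ (b ⊓ z)) ⊔ ocompl z) :=
        le_inf inf_le_right (inf_le_left.trans (sup_le ha hb))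
    _ = (a ⊓ z) ⊔ (b ⊓ z) := inf_sup_ocompl_of_le hm

lemma sup_inf_ocompl_le {z : α} (hz : CommutesWithAll z) (a : α) :
    (a ⊔ z) ⊓ ocompl z ≤ a := by
  rw [hz.compl.sup_inf_right, inf_ocompl, sup_bot_eq]
  exact inf_le_left

lemma sup_inf_left {z : α} (hz : CommutesWithAll z) (a b : α) :
    (a ⊔ z) ⊓ b = (a ⊓ b) ⊔ (z ⊓ b) := by
  refine le_antisymm ?_ (sup_le (inf_le_inf_right b le_sup_left) (inf_le_inf_right b le_sup_right))
  refine (hz _).trans (sup_le ?_ ?_)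
  · exact (le_inf inf_le_right (inf_le_left.trans inf_le_right)).trans le_sup_right
  · refine (le_inf ?_ (inf_le_left.trans inf_le_right)).trans le_sup_left
    exact (inf_le_inf_right _ inf_le_left).trans (hz.sup_inf_ocompl_le a)

lemma inf_sup_right {z : α} (hz : CommutesWithAll z) (a b : α) :
    (a ⊓ b) ⊔ z = (a ⊔ z) ⊓ (b ⊔ z) := by
  have := congrArg ocompl (hz.compl.sup_inf_right (ocompl a) (ocompl b))
  simpa only [ocompl_sup, ocompl_inf, ocompl_ocompl] using this

lemma inf_sup_left {z : α} (hz : CommutesWithAll z) (a b : α) :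
    (a ⊓ z) ⊔ b = (a ⊔ b) ⊓ (z ⊔ b) := by
  have := congrArg ocompl (hz.compl.sup_inf_left (ocompl a) (ocompl b))
  simpa only [ocompl_sup, ocompl_inf, ocompl_ocompl] using this

lemma isCentral {z : α} (hz : CommutesWithAll z) : IsCentral z := by
  have outer : ∀ a b : α, DistribTriple a b z := fun a b =>
    ⟨hz.sup_inf_right a b, hz.inf_sup_right a b⟩
  have middle : ∀ a b : α, DistribTriple a z b := fun a b =>
    ⟨hz.sup_inf_left a b, hz.inf_sup_left a b⟩
  have first : ∀ a b : α, DistribTriple z a b := fun a b => by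
    refine ⟨?_, ?_⟩
    · rw [sup_comm z a, hz.sup_inf_left, sup_comm]
    · rw [inf_comm z a, hz.inf_sup_left, inf_comm]
  exact fun a b => ⟨outer a b, middle a b, outer b a, middle b a, first a b, first b a⟩

end CommutesWithAll

lemma IsCentral.inf_ocompl_sup_le {z : α} (hz : IsCentral z) (a : α) :
    a ⊓ (ocompl a ⊔ z) ≤ z := by
  have h : (ocompl a ⊔ z) ⊓ a = (ocompl a ⊓ a) ⊔ (z ⊓ a) := (hz (ocompl a) a).2.1.1
  rw [inf_comm a, h, inf_comm (ocompl a), inf_ocompl, bot_sup_eq]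
  exact inf_le_left

lemma isCentral_sInf {β : Type u} [CompleteLattice β] [OrthoStructure β] {S : Set β}
    (hS : ∀ z ∈ S, IsCentral z) : IsCentral (sInf S) := by
  refine CommutesWithAll.isCentral fun a => ?_
  have hle : ocompl (a ⊓ ocompl (sInf S)) ⊓ a ≤ sInf S := by
    refine le_sInf fun z hz => ?_
    rw [ocompl_inf, ocompl_ocompl, inf_comm]
    exact (inf_le_inf_left a (sup_le_sup_left (sInf_le hz) _)).trans
      ((hS z hz).inf_ocompl_sup_le a)
  calc a = (a ⊓ ocompl (sInf S)) ⊔ (ocompl (a ⊓ ocompl (sInf S)) ⊓ a) :=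
        (sup_ocompl_inf_of_le inf_le_left).symm
    _ ≤ (a ⊓ sInf S) ⊔ (a ⊓ ocompl (sInf S)) :=
        sup_le le_sup_right ((le_inf inf_le_right hle).trans le_sup_left)

/-- Every complete orthomodular lattice is Boolean saturated: for each `p`, the
set of central elements above `p` has a minimum, namely its infimum, which is
central and lies above `p`. -/
theorem completeOML_booleanSaturated {β : Type u} [CompleteLattice β] [OrthoStructure β]
    (p : β) :
    IsLeast {z : β | IsCentral z ∧ p ≤ z} (sInf {z : β | IsCentral z ∧ p ≤ z}) :=
  ⟨⟨isCentral_sInf fun _ hz => hz.1, le_sInf fun _ hz => hz.2⟩, fun _ hz => sInf_le hz⟩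
end

section
/- Let L be a Boolean saturated orthomodular lattice and p ∈ L with p ∉ Z(L). Then there exists a Boolean valuation v on the Boolean algebra Z(L) (a homomorphism v : Z(L) → 2 into the two-element Boolean algebra, preserving ∧, ∨, ¬, 0, 1) such that v(◇p) = 1 and v(◇¬p) = 1; that is, the subcontraries ◇p and ◇¬p can both be true, and hence the contraries ¬◇p and ¬◇¬p can both be false. -/
universe u

open OrthoStructure

variable {α : Type u} [Lattice α] [BoundedOrder α] [OrthoStructure α]

/-- A Boolean saturated orthomodular lattice: every element has a smallest
central element `dia p` above it. -/
class BooleanSaturated (α : Type u) [Lattice α] [BoundedOrder α] [OrthoStructure α] where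
  dia : α → α
  dia_least : ∀ p : α, IsLeast {z : α | IsCentral z ∧ p ≤ z} (dia p)

open BooleanSaturated


/-- A Boolean valuation on the center: a map into the two-element Boolean
algebra `Bool` preserving `⊓`, `⊔`, orthocomplement, `⊥` and `⊤` on central
elements. -/
def IsCenterValuation {β : Type u} [Lattice β] [BoundedOrder β] [OrthoStructure β]
    (v : β → Bool) : Prop :=
  v ⊥ = false ∧ v ⊤ = true ∧
  (∀ x y : β, IsCentral x → IsCentral y → v (x ⊓ y) = (v x && v y)) ∧
  (∀ x y : β, IsCentral x → IsCentral y → v (x ⊔ y) = (v x || v y)) ∧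
  (∀ x : β, IsCentral x → v (OrthoStructure.ocompl x) = !v x)


theorem sup_ocompl (x : α) : x ⊔ ocompl x = ⊤ := by
  simpa using orthomodular x ⊤

theorem IsCentral.inf_sup_inf_ocompl {z : α} (hz : IsCentral z) (a : α) :
    (a ⊓ z) ⊔ (a ⊓ ocompl z) = a := by
  have h := (hz (ocompl z) a).2.2.2.2.1.1
  rw [sup_ocompl, top_inf_eq] at h
  rw [inf_comm a, inf_comm a, ← h]

/-- If the central covers of `p` and `ocompl p` are disjoint, then `p` is central. -/
theorem isCentral_of_dia_inf_dia_ocompl_eq_bot [BooleanSaturated α] {p : α}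
    (h : dia p ⊓ dia (ocompl p) = ⊥) : IsCentral p := by
  obtain ⟨hc, hpc⟩ := (dia_least p).1
  have hd : ocompl p ≤ dia (ocompl p) := (dia_least (ocompl p)).1.2
  have hdist := (hc p (ocompl p)).1.1
  rw [sup_ocompl, top_inf_eq] at hdist
  have hbot : ocompl p ⊓ dia p = ⊥ := by
    rw [eq_bot_iff, ← h, inf_comm]
    exact inf_le_inf_left _ hd
  rw [hbot, sup_bot_eq, inf_eq_left.2 hpc] at hdist
  exact hdist ▸ hc

/-- A nonzero element of a bounded meet-semilattice lies in a maximal proper filter. -/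
theorem exists_maximal_proper_filter {β : Type*} [SemilatticeInf β] [BoundedOrder β] {e : β}
    (he : e ≠ ⊥) :
    ∃ F : Set β, e ∈ F ∧ ⊥ ∉ F ∧ (∀ x y, x ⊓ y ∈ F ↔ x ∈ F ∧ y ∈ F) ∧
      ∀ x, x ∉ F → ∃ f ∈ F, f ⊓ x = ⊥ := by
  let S : Set (Set β) := {F | ⊥ ∉ F ∧ ∀ x y, x ⊓ y ∈ F ↔ x ∈ F ∧ y ∈ F}
  have hunion : ∀ C ⊆ S, IsChain (· ⊆ ·) C → ⋃₀ C ∈ S := by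
    refine fun C hC hchain => ⟨?_, ?_⟩
    · rintro ⟨s, hs, hbot⟩
      exact (hC hs).1 hbot
    · refine fun x y => ⟨?_, ?_⟩
      · rintro ⟨s, hs, hxy⟩
        exact ⟨⟨s, hs, (((hC hs).2 x y).1 hxy).1⟩, ⟨s, hs, (((hC hs).2 x y).1 hxy).2⟩⟩
      · rintro ⟨⟨s, hs, hxs⟩, ⟨t, ht, hyt⟩⟩
        obtain h | h := hchain.total hs ht
        · exact ⟨t, ht, ((hC ht).2 x y).2 ⟨h hxs, hyt⟩⟩
        · exact ⟨s, hs, ((hC hs).2 x y).2 ⟨hxs, h hyt⟩⟩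
  obtain ⟨F, heF, hF⟩ := zorn_subset_nonempty S
    (fun C hC hchain _ => ⟨⋃₀ C, hunion C hC hchain, fun s hs => Set.subset_sUnion_of_mem hs⟩)
    (Set.Ici e) ⟨by simpa using he, fun x y => by simp⟩
  have he' : e ∈ F := heF (Set.mem_Ici.2 le_rfl)
  refine ⟨F, he', hF.prop.1, hF.prop.2, fun x hx => ?_⟩
  by_contra! hne
  have hup : ∀ {a b : β}, a ≤ b → a ∈ F → b ∈ F := fun {a b} hab ha =>
    ((hF.prop.2 a b).1 (by rwa [inf_eq_left.2 hab])).2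
  refine hx (hF.le_of_ge (y := {y | ∃ f ∈ F, f ⊓ x ≤ y}) ⟨?_, fun y z => ⟨?_, ?_⟩⟩
    (fun f hf => ⟨f, hf, inf_le_left⟩) ⟨e, he', inf_le_right⟩)
  · rintro ⟨f, hf, hfx⟩
    exact hne f hf (le_bot_iff.1 hfx)
  · rintro ⟨f, hf, hfx⟩
    exact ⟨⟨f, hf, hfx.trans inf_le_left⟩, ⟨f, hf, hfx.trans inf_le_right⟩⟩
  · rintro ⟨⟨f, hf, hfx⟩, ⟨g, hg, hgx⟩⟩
    exact ⟨f ⊓ g, (hF.prop.2 f g).2 ⟨hf, hg⟩,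
      le_inf ((inf_le_inf_right x inf_le_left).trans hfx)
        ((inf_le_inf_right x inf_le_right).trans hgx)⟩

/-- Every nonzero element is made true by some valuation on the center which is compatible
with all binary meets. -/
theorem exists_isCenterValuation_of_ne_bot {e : α} (he : e ≠ ⊥) :
    ∃ v : α → Bool, IsCenterValuation v ∧ (∀ x y, v (x ⊓ y) = (v x && v y)) ∧ v e = true := by
  classical
  obtain ⟨F, heF, hbot, hinf, hmax⟩ := exists_maximal_proper_filter he
  have hup : ∀ {a b : α}, a ≤ b → a ∈ F → b ∈ F := fun {a b} hab ha =>
    ((hinf a b).1 (by rwa [inf_eq_left.2 hab])).2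
  have hcompl : ∀ x, IsCentral x → (ocompl x ∈ F ↔ x ∉ F) := by
    refine fun x hx => ⟨fun h h' => hbot (inf_ocompl x ▸ (hinf _ _).2 ⟨h', h⟩), fun h => ?_⟩
    by_contra h'
    obtain ⟨f, hf, hfx⟩ := hmax x h
    obtain ⟨g, hg, hgx⟩ := hmax _ h'
    have hfg : f ⊓ g = ⊥ := by
      rw [← hx.inf_sup_inf_ocompl (f ⊓ g), eq_bot_iff]
      exact sup_le ((inf_le_inf_right _ inf_le_left).trans hfx.le)
        ((inf_le_inf_right _ inf_le_right).trans hgx.le)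
    exact hbot (hfg ▸ (hinf f g).2 ⟨hf, hg⟩)
  have hsup : ∀ x y, IsCentral x → IsCentral y → (x ⊔ y ∈ F ↔ x ∈ F ∨ y ∈ F) := by
    refine fun x y hx hy => ⟨fun h => or_iff_not_imp_left.2 fun hxF => ?_,
      fun h => h.elim (hup le_sup_left) (hup le_sup_right)⟩
    have h' := (hinf _ _).2 ⟨h, (hcompl x hx).2 hxF⟩
    rw [(hy x (ocompl x)).2.1.1, inf_ocompl, bot_sup_eq] at h'
    exact hup inf_le_left h'
  have hv : ∀ x y, decide (x ⊓ y ∈ F) = (decide (x ∈ F) && decide (y ∈ F)) := fun x y => by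
    simp [hinf]
  refine ⟨fun x => decide (x ∈ F), ⟨by simpa using hbot, by simpa using hup le_top heF,
    fun x y _ _ => hv x y, fun x y hx hy => ?_, fun x hx => ?_⟩, hv, by simpa using heF⟩
  · simp [hsup x y hx hy]
  · simp [hcompl x hx]

/-- For a non-central `p` there is a Boolean valuation on the center making
both subcontraries `◇p` and `◇¬p` true, hence both contraries `¬◇p` and
`¬◇¬p` false. -/
theorem exists_valuation_subcontraries_true [BooleanSaturated α] (p : α)
    (hp : p ∉ center α) :
    ∃ v : α → Bool, IsCenterValuation v ∧
      v (dia p) = true ∧ v (dia (ocompl p)) = true ∧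
      v (ocompl (dia p)) = false ∧ v (ocompl (dia (ocompl p))) = false := by
  obtain ⟨v, hv, hinf, h⟩ := exists_isCenterValuation_of_ne_bot
    (mt isCentral_of_dia_inf_dia_ocompl_eq_bot hp)
  have hdia : v (dia p) = true ∧ v (dia (ocompl p)) = true := by
    simpa [hinf] using h
  have hcompl := hv.2.2.2.2
  refine ⟨v, hv, hdia.1, hdia.2, ?_, ?_⟩
  · simp [hcompl _ (dia_least p).1.1, hdia.1]
  · simp [hcompl _ (dia_least (ocompl p)).1.1, hdia.2]
end
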